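/- Under hypotheses (H0)-(H4), for every nonzero vector q ∈ ℝ^{d−1}×[0,∞) there is a unique point â(q) ∈ D̂∩∂₊D for which q belongs to the normal cone V(â(q)) of D̂ at â(q). -/

import Mathlib

open scoped ENNReal
open Filter MeasureTheory

namespace ReflectedRW

/-- `ℤ^d` realized as `ℤ^{d-1} × ℤ`. -/
abbrev Zd (d : ℕ) := (Fin (d-1) → ℤ) × ℤ
/-- `ℝ^d` realized as `ℝ^{d-1} × ℝ`. -/
abbrev Rd (d : ℕ) := (Fin (d-1) → ℝ) × ℝ
/-- The state space `ℤ^{d-1} × ℕ` of the reflected walk. -/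
abbrev St (d : ℕ) := (Fin (d-1) → ℤ) × ℕ

/-- Embedding of the state space into `ℤ^d`. -/
def toZ (d : ℕ) (z : St d) : Zd d := (z.1, (z.2 : ℤ))

/-- Embedding of `ℤ^d` into `ℝ^d`. -/
def toR (d : ℕ) (z : Zd d) : Rd d := (fun i => (z.1 i : ℝ), (z.2 : ℝ))

/-- Scalar product `a · z` of `a ∈ ℝ^d` and `z ∈ ℤ^d`. -/
noncomputable def dotZ (d : ℕ) (a : Rd d) (z : Zd d) : ℝ :=
  (∑ i, a.1 i * (z.1 i : ℝ)) + a.2 * (z.2 : ℝ)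

/-- Scalar product on `ℝ^d`. -/
noncomputable def dotR (d : ℕ) (a q : Rd d) : ℝ :=
  (∑ i, a.1 i * q.1 i) + a.2 * q.2

/-- One-step transition probabilities of the reflected random walk `Z(t)`:
jumps with law `μ` in the interior and with law `μ0` on the boundary `y = 0`. -/
noncomputable def step (d : ℕ) (μ μ0 : Zd d → ℝ) (z z' : St d) : ℝ≥0∞ :=
  if z.2 = 0 then ENNReal.ofReal (μ0 (toZ d z' - toZ d z))
  else ENNReal.ofReal (μ (toZ d z' - toZ d z))

/-- Real-valued version of the transition kernel of `Z(t)`. -/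
noncomputable def stepR (d : ℕ) (μ μ0 : Zd d → ℝ) (z z' : St d) : ℝ :=
  if z.2 = 0 then μ0 (toZ d z' - toZ d z) else μ (toZ d z' - toZ d z)

/-- `n`-step kernel obtained by iterating a sub-Markov kernel `p`. -/
noncomputable def kerIter {S : Type*} [DecidableEq S] (p : S → S → ℝ≥0∞) :
    ℕ → S → S → ℝ≥0∞
  | 0, z, z' => if z = z' then 1 else 0
  | n+1, z, z' => ∑' w : S, kerIter p n z w * p w z'

/-- `n`-step transition probabilities of `Z(t)`: `P_z(Z(n) = z')`. -/
noncomputable def stepn (d : ℕ) (μ μ0 : Zd d → ℝ) : ℕ → St d → St d → ℝ≥0∞ :=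
  kerIter (step d μ μ0)

/-- Green's function `G(z,z') = ∑_{t ≥ 0} P_z(Z(t) = z')` of the reflected walk. -/
noncomputable def green (d : ℕ) (μ μ0 : Zd d → ℝ) (z z' : St d) : ℝ≥0∞ :=
  ∑' n : ℕ, stepn d μ μ0 n z z'

/-- Kernel of the walk killed upon hitting the boundary hyperplane `y = 0`. -/
noncomputable def stepKilled (d : ℕ) (μ μ0 : Zd d → ℝ) (z z' : St d) : ℝ≥0∞ :=
  if z'.2 = 0 then 0 else step d μ μ0 z z'

/-- `n`-step kernel of the killed walk: `P_z(Z(n) = z', τ > n)` where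
`τ` is the first return time to the boundary hyperplane. -/
noncomputable def stepKilledn (d : ℕ) (μ μ0 : Zd d → ℝ) : ℕ → St d → St d → ℝ≥0∞ :=
  kerIter (stepKilled d μ μ0)

/-- Green's function `G₊(z,z')` of the killed walk. -/
noncomputable def greenPlus (d : ℕ) (μ μ0 : Zd d → ℝ) (z z' : St d) : ℝ≥0∞ :=
  ∑' n : ℕ, stepKilledn d μ μ0 n z z'

/-- One-step kernel of the homogeneous random walk `S(t)` on `ℤ^d`. -/
noncomputable def stepS (d : ℕ) (μ : Zd d → ℝ) (z z' : Zd d) : ℝ≥0∞ :=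
  ENNReal.ofReal (μ (z' - z))

/-- `n`-step kernel of the homogeneous random walk on `ℤ^d`. -/
noncomputable def stepSn (d : ℕ) (μ : Zd d → ℝ) : ℕ → Zd d → Zd d → ℝ≥0∞ :=
  kerIter (stepS d μ)

/-- Green's function `G_S` of the homogeneous random walk on `ℤ^d`. -/
noncomputable def greenS (d : ℕ) (μ : Zd d → ℝ) (z z' : Zd d) : ℝ≥0∞ :=
  ∑' n : ℕ, stepSn d μ n z z'

/-- `hitProb z w = P_z(τ < ∞, Z(τ) = w)`, the hitting distribution on the boundary
hyperplane, `τ = inf{t ≥ 1 : Z(t) ∈ ℤ^{d-1}×{0}}`. -/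
noncomputable def hitProb (d : ℕ) (μ μ0 : Zd d → ℝ) (z w : St d) : ℝ≥0∞ :=
  if w.2 = 0 then
    ∑' n : ℕ, ∑' v : St d, stepKilledn d μ μ0 n z v * step d μ μ0 v w
  else 0

/-- The jump generating function `φ(a) = ∑_z μ(z) e^{a·z}`. -/
noncomputable def jgf (d : ℕ) (μ : Zd d → ℝ) (a : Rd d) : ℝ :=
  ∑' z : Zd d, μ z * Real.exp (dotZ d a z)

/-- Partial derivative `∂φ/∂β` of the jump generating function in the last coordinate. -/
noncomputable def jgfDβ (d : ℕ) (μ : Zd d → ℝ) (a : Rd d) : ℝ :=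
  ∑' z : Zd d, μ z * (z.2 : ℝ) * Real.exp (dotZ d a z)

/-- Gradient `∇φ(a)` of the jump generating function. -/
noncomputable def jgfGrad (d : ℕ) (μ : Zd d → ℝ) (a : Rd d) : Rd d :=
  (fun i => ∑' z : Zd d, μ z * (z.1 i : ℝ) * Real.exp (dotZ d a z), jgfDβ d μ a)

/-- The set `D = {a : φ(a) ≤ 1}`. -/
def Dset (d : ℕ) (μ : Zd d → ℝ) : Set (Rd d) := {a | jgf d μ a ≤ 1}

/-- `∂₊D`: points of the boundary of `D` where the last coordinate of `∇φ` is `≥ 0`. -/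
def bdPlus (d : ℕ) (μ : Zd d → ℝ) : Set (Rd d) :=
  {a | jgf d μ a = 1 ∧ 0 ≤ jgfDβ d μ a}

/-- `∂₋D`: points of the boundary of `D` where the last coordinate of `∇φ` is `≤ 0`. -/
def bdMinus (d : ℕ) (μ : Zd d → ℝ) : Set (Rd d) :=
  {a | jgf d μ a = 1 ∧ jgfDβ d μ a ≤ 0}

/-- `∂₀D`: points of the boundary of `D` where the last coordinate of `∇φ` is `0`. -/
def bdZero (d : ℕ) (μ : Zd d → ℝ) : Set (Rd d) :=
  {a | jgf d μ a = 1 ∧ jgfDβ d μ a = 0}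

/-- `Θ = {α ∈ ℝ^{d-1} : inf_β max(φ(α,β), φ₀(α,β)) ≤ 1}`. -/
noncomputable def Theta (d : ℕ) (μ μ0 : Zd d → ℝ) : Set (Fin (d-1) → ℝ) :=
  {α | (⨅ β : ℝ, max (jgf d μ (α, β)) (jgf d μ0 (α, β))) ≤ 1}

/-- `D̂ = (Θ×ℝ) ∩ D`. -/
noncomputable def Dhat (d : ℕ) (μ μ0 : Zd d → ℝ) : Set (Rd d) :=
  {a | a.1 ∈ Theta d μ μ0 ∧ jgf d μ a ≤ 1}

/-- Normal cone to a convex set `s ⊆ ℝ^d` at the point `a`. -/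
noncomputable def normalCone (d : ℕ) (s : Set (Rd d)) (a : Rd d) : Set (Rd d) :=
  {q | ∀ b ∈ s, dotR d q (b - a) ≤ 0}

/-- The mean vector `m = ∑_z z μ(z)`. -/
noncomputable def meanVec (d : ℕ) (μ : Zd d → ℝ) : Rd d :=
  (fun i => ∑' z : Zd d, μ z * (z.1 i : ℝ), ∑' z : Zd d, μ z * (z.2 : ℝ))

/-- The harmonic functions `h_a` of (1-8), for `a ∈ D̂ ∩ ∂₊D` with associated
point `abar = ā ∈ ∂₋D` (same first `d-1` coordinates as `a`). -/
noncomputable def hfun (d : ℕ) (μ μ0 : Zd d → ℝ) (a abar : Rd d) (z : St d) : ℝ :=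
  if jgf d μ0 abar = 1 then Real.exp (dotZ d abar (toZ d z))
  else if a = abar then
    (z.2 : ℝ) * Real.exp (dotZ d a (toZ d z))
      + (jgfDβ d μ0 a / (1 - jgf d μ0 a)) * Real.exp (dotZ d a (toZ d z))
  else
    Real.exp (dotZ d a (toZ d z))
      - ((1 - jgf d μ0 a) / (1 - jgf d μ0 abar)) * Real.exp (dotZ d abar (toZ d z))

/-- `h : ℤ^{d-1}×ℕ → ℝ` is harmonic for the reflected walk. -/
def IsHarmonic (d : ℕ) (μ μ0 : Zd d → ℝ) (h : St d → ℝ) : Prop :=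
  ∀ z : St d, HasSum (fun z' => stepR d μ μ0 z z' * h z') (h z)

/-- Minimal nonnegative harmonic function. -/
def IsMinimalHarmonic (d : ℕ) (μ μ0 : Zd d → ℝ) (h : St d → ℝ) : Prop :=
  IsHarmonic d μ μ0 h ∧ (∀ z, 0 ≤ h z) ∧ h ≠ 0 ∧
    ∀ h' : St d → ℝ, IsHarmonic d μ μ0 h' → (∀ z, 0 ≤ h' z) → h' ≠ 0 →
      (∀ z, h' z ≤ h z) → ∃ c : ℝ, 0 < c ∧ h' = fun z => c * h z

/- Hypotheses (H0)–(H4). -/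

/-- `(H0)`: `μ(x,y) = 0` for `y < -1` and `μ₀(x,y) = 0` for `y < 0`. -/
def H0 (d : ℕ) (μ μ0 : Zd d → ℝ) : Prop :=
  (∀ z : Zd d, z.2 < -1 → μ z = 0) ∧ (∀ z : Zd d, z.2 < 0 → μ0 z = 0)

/-- `(H1)`: the reflected walk is irreducible on `ℤ^{d-1}×ℕ`. -/
def H1 (d : ℕ) (μ μ0 : Zd d → ℝ) : Prop :=
  ∀ z z' : St d, ∃ n : ℕ, 0 < stepn d μ μ0 n z z'

/-- `(H2)`: the homogeneous walk with step law `μ` is irreducible on `ℤ^d` and its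
last coordinate is an aperiodic random walk on `ℤ`. -/
def H2 (d : ℕ) (μ : Zd d → ℝ) : Prop :=
  (∀ z z' : Zd d, ∃ n : ℕ, 0 < stepSn d μ n z z') ∧
    AddSubgroup.closure {y : ℤ | ∃ x : Fin (d-1) → ℤ, μ (x, y) ≠ 0} = ⊤

/-- `(H3)`: `m ≠ 0` and `m/|m| + m₀/|m₀| ≠ 0`. -/
noncomputable def H3 (d : ℕ) (μ μ0 : Zd d → ℝ) : Prop :=
  meanVec d μ ≠ 0 ∧ meanVec d μ0 ≠ 0 ∧
    ‖meanVec d μ‖⁻¹ • meanVec d μ + ‖meanVec d μ0‖⁻¹ • meanVec d μ0 ≠ 0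

/-- `(H4)`: the jump generating functions are finite everywhere on `ℝ^d`. -/
def H4 (d : ℕ) (μ μ0 : Zd d → ℝ) : Prop :=
  ∀ a : Rd d, Summable (fun z : Zd d => μ z * Real.exp (dotZ d a z)) ∧
    Summable (fun z : Zd d => μ0 z * Real.exp (dotZ d a z))

/-- `μ` is a probability distribution on `ℤ^d`. -/
def IsProb (d : ℕ) (μ : Zd d → ℝ) : Prop :=
  (∀ z : Zd d, 0 ≤ μ z) ∧ HasSum μ 1

section DotProducts

variable {d : ℕ}

lemma dotZ_add (a b : Rd d) (z : Zd d) : dotZ d (a + b) z = dotZ d a z + dotZ d b z := by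
  simp only [dotZ, Prod.fst_add, Prod.snd_add, Pi.add_apply, add_mul, Finset.sum_add_distrib]
  ring

lemma dotZ_smul (t : ℝ) (a : Rd d) (z : Zd d) : dotZ d (t • a) z = t * dotZ d a z := by
  simp only [dotZ, Prod.smul_fst, Prod.smul_snd, Pi.smul_apply, smul_eq_mul, mul_add,
    Finset.mul_sum, mul_assoc]

lemma dotZ_sub (a b : Rd d) (z : Zd d) : dotZ d (a - b) z = dotZ d a z - dotZ d b z := by
  have h := dotZ_add (a - b) b z
  rw [sub_add_cancel] at h
  linarith

lemma dotZ_zero_left (z : Zd d) : dotZ d 0 z = 0 := by simp [dotZ]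

lemma dotZ_add_right (a : Rd d) (z w : Zd d) : dotZ d a (z + w) = dotZ d a z + dotZ d a w := by
  simp only [dotZ, Prod.fst_add, Prod.snd_add, Pi.add_apply, Int.cast_add, mul_add,
    Finset.sum_add_distrib]
  ring

lemma dotZ_zero_right (a : Rd d) : dotZ d a 0 = 0 := by simp [dotZ]

lemma dotZ_single (a : Rd d) (i : Fin (d-1)) (k : ℤ) :
    dotZ d a (Pi.single i k, 0) = a.1 i * k := by
  simp only [dotZ, Int.cast_zero, mul_zero, add_zero]
  rw [Finset.sum_eq_single i] <;> simp +contextual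

lemma dotZ_vertical (a : Rd d) (k : ℤ) : dotZ d a (0, k) = a.2 * k := by simp [dotZ]

lemma dotZ_last (t : ℝ) (z : Zd d) : dotZ d (0, t) z = t * z.2 := by simp [dotZ]

lemma dotR_add (q a b : Rd d) : dotR d q (a + b) = dotR d q a + dotR d q b := by
  simp only [dotR, Prod.fst_add, Prod.snd_add, Pi.add_apply, mul_add, Finset.sum_add_distrib]
  ring

lemma dotR_smul (q : Rd d) (t : ℝ) (a : Rd d) : dotR d q (t • a) = t * dotR d q a := by
  simp only [dotR, Prod.smul_fst, Prod.smul_snd, Pi.smul_apply, smul_eq_mul, mul_add,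
    Finset.mul_sum, mul_left_comm]

lemma dotR_sub (q a b : Rd d) : dotR d q (a - b) = dotR d q a - dotR d q b := by
  have h := dotR_add q (a - b) b
  rw [sub_add_cancel] at h
  linarith

lemma dotR_last (q : Rd d) (t : ℝ) : dotR d q (0, t) = q.2 * t := by simp [dotR]

lemma dotR_self_pos {q : Rd d} (hq : q ≠ 0) : 0 < dotR d q q := by
  have h1 : 0 ≤ ∑ i, q.1 i * q.1 i := Finset.sum_nonneg fun i _ => mul_self_nonneg _
  have h2 : 0 ≤ q.2 * q.2 := mul_self_nonneg _
  refine lt_of_le_of_ne (add_nonneg h1 h2) fun h => hq ?_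
  have h' : ∑ i, q.1 i * q.1 i + q.2 * q.2 = 0 := h.symm
  have e1 : ∑ i, q.1 i * q.1 i = 0 := by linarith
  have e2 : q.2 * q.2 = 0 := by linarith
  rw [Finset.sum_eq_zero_iff_of_nonneg fun i _ => mul_self_nonneg _] at e1
  refine Prod.ext (funext fun i => ?_) (mul_self_eq_zero.1 e2)
  exact mul_self_eq_zero.1 (e1 i (Finset.mem_univ i))

lemma continuous_dotR (q : Rd d) : Continuous (dotR d q) := by
  unfold dotR
  fun_prop

end DotProducts

/-- A property preserved by every transition of positive weight holds at every point reached with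
positive weight. -/
lemma kerIter_induction {S : Type*} [DecidableEq S] {p : S → S → ℝ≥0∞} {P : S → Prop} {z : S}
    (h0 : P z) (hstep : ∀ w w', P w → p w w' ≠ 0 → P w') :
    ∀ n w, kerIter p n z w ≠ 0 → P w := by
  intro n
  induction n with
  | zero =>
    intro w hw
    by_cases h : z = w
    · exact h ▸ h0
    · simp [kerIter, h] at hw
  | succ n ih =>
    intro w hw
    simp only [kerIter, ne_eq, ENNReal.tsum_eq_zero, not_forall, mul_eq_zero, not_or] at hw
    obtain ⟨v, hv, hvw⟩ := hw
    exact hstep v w (ih v hv) hvw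

section Irreducible

variable {d : ℕ} {μ : Zd d → ℝ}

/-- A property of `ℤ^d` valid at `0` and preserved by the steps of an irreducible walk holds
everywhere. -/
lemma irreducible_induction (hirr : ∀ z z' : Zd d, ∃ n : ℕ, 0 < stepSn d μ n z z')
    {P : Zd d → Prop} (h0 : P 0) (hstep : ∀ w v, P w → 0 < μ v → P (w + v)) (w : Zd d) : P w := by
  obtain ⟨n, hn⟩ := hirr 0 w
  refine kerIter_induction h0 (fun w w' hw hp => ?_) n w hn.ne'
  have : 0 < μ (w' - w) := by simpa [stepS] using hp
  simpa using hstep w (w' - w) hw this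

lemma exists_dotZ_ne_zero (hirr : ∀ z z' : Zd d, ∃ n : ℕ, 0 < stepSn d μ n z z')
    {v : Rd d} (hv : v ≠ 0) : ∃ z, 0 < μ z ∧ dotZ d v z ≠ 0 := by
  by_contra! h
  have key : ∀ w, dotZ d v w = 0 := irreducible_induction hirr (dotZ_zero_right v)
    fun w z hw hz => by rw [dotZ_add_right, hw, h z hz, add_zero]
  refine hv (Prod.ext (funext fun i => ?_) ?_)
  · simpa [dotZ_single] using key (Pi.single i 1, 0)
  · simpa [dotZ_vertical] using key (0, 1)

end Irreducible

section GeneratingFunction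

variable {d : ℕ} {ν : Zd d → ℝ}

lemma exp_dotZ_convex (z : Zd d) (a b : Rd d) {s t : ℝ} (hs : 0 ≤ s) (ht : 0 ≤ t)
    (hst : s + t = 1) :
    Real.exp (dotZ d (s • a + t • b) z) ≤
      s * Real.exp (dotZ d a z) + t * Real.exp (dotZ d b z) := by
  rw [dotZ_add, dotZ_smul, dotZ_smul]
  exact convexOn_exp.2 (Set.mem_univ _) (Set.mem_univ _) hs ht hst

lemma convexOn_jgf (hν : ∀ z, 0 ≤ ν z)
    (hsum : ∀ a, Summable fun z => ν z * Real.exp (dotZ d a z)) :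
    ConvexOn ℝ Set.univ (jgf d ν) := by
  refine ⟨convex_univ, fun a _ b _ s t hs ht hst => ?_⟩
  simp only [jgf, smul_eq_mul, ← tsum_mul_left]
  rw [← ((hsum a).mul_left s).tsum_add ((hsum b).mul_left t)]
  refine (hsum _).tsum_le_tsum (fun z => ?_) (((hsum a).mul_left s).add ((hsum b).mul_left t))
  nlinarith [mul_le_mul_of_nonneg_left (exp_dotZ_convex z a b hs ht hst) (hν z)]

lemma continuous_jgf (hν : ∀ z, 0 ≤ ν z)
    (hsum : ∀ a, Summable fun z => ν z * Real.exp (dotZ d a z)) : Continuous (jgf d ν) := by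
  have h := (convexOn_jgf hν hsum).continuousOn isOpen_univ
  exact continuousOn_univ.1 h

lemma strictConvexOn_jgf (hν : ∀ z, 0 ≤ ν z)
    (hsum : ∀ a, Summable fun z => ν z * Real.exp (dotZ d a z))
    (hsep : ∀ v : Rd d, v ≠ 0 → ∃ z, 0 < ν z ∧ dotZ d v z ≠ 0) :
    StrictConvexOn ℝ Set.univ (jgf d ν) := by
  refine ⟨convex_univ, fun a _ b _ hab s t hs ht hst => ?_⟩
  obtain ⟨z₀, hz₀, hne⟩ := hsep (a - b) (sub_ne_zero.2 hab)
  simp only [jgf, smul_eq_mul, ← tsum_mul_left]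
  rw [← ((hsum a).mul_left s).tsum_add ((hsum b).mul_left t)]
  refine Summable.tsum_lt_tsum (i := z₀) (fun z => ?_) ?_ (hsum _)
    (((hsum a).mul_left s).add ((hsum b).mul_left t))
  · nlinarith [mul_le_mul_of_nonneg_left (exp_dotZ_convex z a b hs.le ht.le hst) (hν z)]
  · rw [dotZ_sub, sub_ne_zero] at hne
    have h := strictConvexOn_exp.2 (Set.mem_univ _) (Set.mem_univ _) hne hs ht hst
    simp only [smul_eq_mul] at h
    rw [dotZ_add, dotZ_smul, dotZ_smul]
    nlinarith [mul_lt_mul_of_pos_left h hz₀]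

lemma jgf_zero (hν : HasSum ν 1) : jgf d ν 0 = 1 := by
  simp [jgf, dotZ_zero_left, hν.tsum_eq]

lemma exists_norm_le_of_jgf_le (hν : ∀ z, 0 ≤ ν z)
    (hsum : ∀ a, Summable fun z => ν z * Real.exp (dotZ d a z))
    (hirr : ∀ z z' : Zd d, ∃ n : ℕ, 0 < stepSn d ν n z z') (M : ℝ) :
    ∃ R, ∀ a, jgf d ν a ≤ M → ‖a‖ ≤ R := by
  have key : ∀ w, ∃ C, ∀ a, jgf d ν a ≤ M → dotZ d a w ≤ C := by
    refine irreducible_induction hirr ⟨0, fun a _ => (dotZ_zero_right a).le⟩ ?_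
    rintro w v ⟨C, hC⟩ hv
    refine ⟨C + M / ν v, fun a ha => ?_⟩
    rw [dotZ_add_right]
    have h1 : ν v * Real.exp (dotZ d a v) ≤ M :=
      ((hsum a).le_tsum v fun z _ => mul_nonneg (hν z) (Real.exp_nonneg _)).trans ha
    have h2 : Real.exp (dotZ d a v) ≤ M / ν v := by
      rw [le_div_iff₀ hv]
      linarith
    have h3 := Real.add_one_le_exp (dotZ d a v)
    linarith [hC a ha]
  choose C hC using key
  have hvert : ∀ a, jgf d ν a ≤ M → ‖a.2‖ ≤ max (C (0, 1)) (C (0, -1)) := by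
    intro a ha
    have h1 := hC (0, 1) a ha
    have h2 := hC (0, -1) a ha
    rw [dotZ_vertical] at h1 h2
    push_cast at h1 h2
    rw [Real.norm_eq_abs, abs_le']
    exact ⟨by linarith [le_max_left (C (0, 1)) (C (0, -1))],
      by linarith [le_max_right (C (0, 1)) (C (0, -1))]⟩
  have hhor : ∀ i, ∀ a, jgf d ν a ≤ M →
      ‖a.1 i‖ ≤ max (C (Pi.single i 1, 0)) (C (Pi.single i (-1), 0)) := by
    intro i a ha
    have h1 := hC (Pi.single i 1, 0) a ha
    have h2 := hC (Pi.single i (-1), 0) a ha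
    rw [dotZ_single] at h1 h2
    push_cast at h1 h2
    rw [Real.norm_eq_abs, abs_le']
    exact ⟨by linarith [le_max_left (C (Pi.single i 1, 0)) (C (Pi.single i (-1), 0))],
      by linarith [le_max_right (C (Pi.single i 1, 0)) (C (Pi.single i (-1), 0))]⟩
  obtain ⟨R, hR⟩ := Finset.exists_le
    (Finset.univ.image fun i => max (C (Pi.single i 1, 0)) (C (Pi.single i (-1), 0)))
  refine ⟨max (max R 0) (max (C (0, 1)) (C (0, -1))), fun a ha => ?_⟩
  rw [Prod.norm_def]
  refine max_le_max ?_ (hvert a ha)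
  refine (pi_norm_le_iff_of_nonneg (le_max_right _ _)).2 fun i => ?_
  exact (hhor i a ha).trans ((hR _ (Finset.mem_image_of_mem _ (Finset.mem_univ i))).trans
    (le_max_left _ _))

lemma isCompact_jgf_le (hν : ∀ z, 0 ≤ ν z)
    (hsum : ∀ a, Summable fun z => ν z * Real.exp (dotZ d a z))
    (hirr : ∀ z z' : Zd d, ∃ n : ℕ, 0 < stepSn d ν n z z') (M : ℝ) :
    IsCompact {a | jgf d ν a ≤ M} := by
  obtain ⟨R, hR⟩ := exists_norm_le_of_jgf_le hν hsum hirr M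
  refine (isCompact_closedBall (0 : Rd d) R).of_isClosed_subset
    (isClosed_le (continuous_jgf hν hsum) continuous_const) fun a ha => ?_
  simpa using hR a ha

lemma hasDerivAt_jgf_last (hν : ∀ z, 0 ≤ ν z)
    (hsum : ∀ a, Summable fun z => ν z * Real.exp (dotZ d a z)) (a : Rd d) :
    HasDerivAt (fun t : ℝ => jgf d ν (a + (0, t))) (jgfDβ d ν a) 0 := by
  have hdot : ∀ (t : ℝ) z, dotZ d (a + (0, t)) z = dotZ d a z + t * z.2 := fun t z => by
    rw [dotZ_add, dotZ_last]
  have hu : Summable fun z : Zd d => ν z * Real.exp (dotZ d (a + (0, 2)) z) +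
      ν z * Real.exp (dotZ d (a + (0, -2)) z) := (hsum _).add (hsum _)
  have hderiv : ∀ (z : Zd d) (t : ℝ), t ∈ Set.Ioo (-1 : ℝ) 1 →
      HasDerivAt (fun t : ℝ => ν z * Real.exp (dotZ d (a + (0, t)) z))
        (ν z * z.2 * Real.exp (dotZ d (a + (0, t)) z)) t := by
    intro z t _
    simp only [hdot]
    have h1 : HasDerivAt (fun t : ℝ => dotZ d a z + t * z.2) (z.2 : ℝ) t := by
      simpa using ((hasDerivAt_id t).mul_const (z.2 : ℝ)).const_add (dotZ d a z)
    convert! (h1.exp.const_mul (ν z)) using 1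
    ring
  have hbound : ∀ (z : Zd d) (t : ℝ), t ∈ Set.Ioo (-1 : ℝ) 1 →
      ‖ν z * z.2 * Real.exp (dotZ d (a + (0, t)) z)‖ ≤
        ν z * Real.exp (dotZ d (a + (0, 2)) z) + ν z * Real.exp (dotZ d (a + (0, -2)) z) := by
    intro z t ht
    simp only [hdot]
    rw [norm_mul, norm_mul, Real.norm_eq_abs, Real.norm_eq_abs, Real.norm_eq_abs,
      abs_of_nonneg (hν z), abs_of_pos (Real.exp_pos _), ← mul_add, mul_assoc]
    refine mul_le_mul_of_nonneg_left ?_ (hν z)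
    have hy : |(z.2 : ℝ)| ≤ Real.exp |(z.2 : ℝ)| := by
      linarith [Real.add_one_le_exp |(z.2 : ℝ)|]
    have hty : t * z.2 ≤ |(z.2 : ℝ)| := by
      refine (le_abs_self _).trans ?_
      rw [abs_mul]
      exact mul_le_of_le_one_left (abs_nonneg _) (abs_le.2 ⟨ht.1.le, ht.2.le⟩)
    calc |(z.2 : ℝ)| * Real.exp (dotZ d a z + t * z.2)
        ≤ Real.exp |(z.2 : ℝ)| * Real.exp (dotZ d a z + |(z.2 : ℝ)|) := by gcongr
      _ = Real.exp (dotZ d a z + 2 * |(z.2 : ℝ)|) := by rw [← Real.exp_add]; ring_nf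
      _ ≤ _ := by
        rcases abs_cases (z.2 : ℝ) with ⟨h, _⟩ | ⟨h, _⟩ <;> rw [h]
        · exact le_add_of_nonneg_right (Real.exp_nonneg _)
        · rw [mul_neg, ← neg_mul]
          exact le_add_of_nonneg_left (Real.exp_nonneg _)
  have h0 : (0 : ℝ) ∈ Set.Ioo (-1 : ℝ) 1 := by norm_num
  have h := hasDerivAt_tsum_of_isPreconnected hu isOpen_Ioo isPreconnected_Ioo hderiv hbound h0
    (hsum _) h0
  have hz : a + ((0, 0) : Rd d) = a := add_zero a
  rw [hz] at h
  exact h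

/-- A point beyond which, in the last coordinate, `φ` exceeds `1` belongs to `∂₊D`. -/
lemma mem_bdPlus_of_forall_gt (hν : ∀ z, 0 ≤ ν z)
    (hsum : ∀ a, Summable fun z => ν z * Real.exp (dotZ d a z)) {a : Rd d}
    (ha : jgf d ν a ≤ 1) (hgt : ∀ t : ℝ, 0 < t → 1 < jgf d ν (a + (0, t))) :
    a ∈ bdPlus d ν := by
  have hz : jgf d ν (a + (0, (0 : ℝ))) = jgf d ν a := by
    rw [show ((0, 0) : Rd d) = 0 from rfl, add_zero]
  have hderiv := hasDerivAt_jgf_last hν hsum a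
  have h1 : jgf d ν a = 1 := by
    refine le_antisymm ha ?_
    rw [← hz]
    refine ge_of_tendsto (hderiv.continuousAt.continuousWithinAt (s := Set.Ioi 0)) ?_
    filter_upwards [self_mem_nhdsWithin] with t ht using (hgt t ht).le
  refine ⟨h1, ge_of_tendsto hderiv.tendsto_slope_zero_right ?_⟩
  filter_upwards [self_mem_nhdsWithin] with t ht
  have ht' : (0 : ℝ) < t := ht
  rw [zero_add, hz, h1, smul_eq_mul]
  exact mul_nonneg (inv_nonneg.2 ht'.le) (sub_nonneg.2 (hgt t ht').le)

/-- Points of `∂₊D` are determined by their first `d - 1` coordinates: one cannot move upwards from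
such a point and remain in `D`. -/
lemma one_lt_jgf_of_mem_bdPlus (hν : ∀ z, 0 ≤ ν z)
    (hsum : ∀ a, Summable fun z => ν z * Real.exp (dotZ d a z))
    (hconv : StrictConvexOn ℝ Set.univ (jgf d ν)) {a : Rd d} (ha : a ∈ bdPlus d ν)
    {t : ℝ} (ht : 0 < t) : 1 < jgf d ν (a + (0, t)) := by
  have hz : a + (0, (0 : ℝ)) = a := by
    rw [show ((0, 0) : Rd d) = 0 from rfl, add_zero]
  have hsec : StrictConvexOn ℝ Set.univ fun t : ℝ => jgf d ν (a + (0, t)) := by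
    refine ⟨convex_univ, fun x _ y _ hxy s r hs hr hsr => ?_⟩
    have hne : a + ((0, x) : Rd d) ≠ a + (0, y) := fun h =>
      hxy (congrArg Prod.snd (add_left_cancel h))
    have h := hconv.2 (Set.mem_univ _) (Set.mem_univ _) hne hs hr hsr
    convert! h using 2
    rw [smul_add, smul_add, add_add_add_comm, ← add_smul, hsr, one_smul]
    simp
  have h := hsec.lt_slope_of_hasDerivAt (Set.mem_univ _) (Set.mem_univ _) ht
    (hasDerivAt_jgf_last hν hsum a)
  have h' := ha.2.trans_lt h
  rw [slope_pos_iff ht, hz, ha.1] at h'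
  exact h'

end GeneratingFunction

section Reflected

variable {d : ℕ} {μ μ0 : Zd d → ℝ}

lemma exists_pos_last_of_irreducible (hH1 : H1 d μ μ0) : ∃ z, μ0 z ≠ 0 ∧ 0 < z.2 := by
  by_contra! h
  obtain ⟨n, hn⟩ := hH1 (0, 0) (0, 1)
  have := kerIter_induction (P := fun w : St d => w.2 = 0) (z := (0, 0)) rfl
    (fun w w' hw hp => ?_) n _ hn.ne'
  · simp at this
  · have hpos : 0 < μ0 (toZ d w' - toZ d w) := by simpa [step, hw] using hp
    have := h _ hpos.ne'
    simp [toZ, hw] at this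
    exact this

/-- `φ₀` is strictly increasing in the last coordinate. -/
lemma jgf_reflection_lt (hμ0 : ∀ z, 0 ≤ μ0 z)
    (hsum : ∀ a, Summable fun z => μ0 z * Real.exp (dotZ d a z))
    (hsupp : ∀ z : Zd d, z.2 < 0 → μ0 z = 0) (hH1 : H1 d μ μ0) (a : Rd d) {t : ℝ} (ht : 0 < t) :
    jgf d μ0 (a + (0, -t)) < jgf d μ0 a := by
  obtain ⟨z₀, hz₀, hpos⟩ := exists_pos_last_of_irreducible hH1
  refine Summable.tsum_lt_tsum (i := z₀) (fun z => ?_) ?_ (hsum _) (hsum _)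
  · rcases lt_or_ge z.2 0 with hz | hz
    · simp [hsupp z hz]
    · refine mul_le_mul_of_nonneg_left (Real.exp_le_exp.2 ?_) (hμ0 z)
      rw [dotZ_add, dotZ_last]
      have : (0 : ℝ) ≤ z.2 := by exact_mod_cast hz
      nlinarith
  · refine mul_lt_mul_of_pos_left (Real.exp_lt_exp.2 ?_) (lt_of_le_of_ne (hμ0 z₀) hz₀.symm)
    rw [dotZ_add, dotZ_last]
    have : (0 : ℝ) < z₀.2 := by exact_mod_cast hpos
    nlinarith

/-- The infimum defining `Θ` is attained. -/
lemma mem_Theta_iff (hμ : ∀ z, 0 ≤ μ z) (hμ0 : ∀ z, 0 ≤ μ0 z)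
    (hsum : ∀ a, Summable fun z => μ z * Real.exp (dotZ d a z))
    (hsum0 : ∀ a, Summable fun z => μ0 z * Real.exp (dotZ d a z))
    (hirr : ∀ z z' : Zd d, ∃ n : ℕ, 0 < stepSn d μ n z z') {α : Fin (d-1) → ℝ} :
    α ∈ Theta d μ μ0 ↔ ∃ β : ℝ, jgf d μ (α, β) ≤ 1 ∧ jgf d μ0 (α, β) ≤ 1 := by
  have hnn : ∀ β : ℝ, 0 ≤ max (jgf d μ (α, β)) (jgf d μ0 (α, β)) := fun β =>
    le_max_of_le_left (tsum_nonneg fun z => mul_nonneg (hμ z) (Real.exp_nonneg _))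
  constructor
  · intro h
    have hc : Continuous fun β : ℝ => max (jgf d μ (α, β)) (jgf d μ0 (α, β)) :=
      ((continuous_jgf hμ hsum).comp (by fun_prop)).max
        ((continuous_jgf hμ0 hsum0).comp (by fun_prop))
    obtain ⟨R, hR⟩ := exists_norm_le_of_jgf_le hμ hsum hirr
      (max (jgf d μ (α, 0)) (jgf d μ0 (α, 0)))
    obtain ⟨β, hβ⟩ := hc.exists_forall_le' 0 (by
      filter_upwards [(isCompact_closedBall (0 : ℝ) R).compl_mem_cocompact] with β hβ
      by_contra! hlt
      refine hβ ?_
      have := hR (α, β) ((le_max_left _ _).trans hlt.le)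
      simpa using (norm_snd_le ((α, β) : Rd d)).trans this)
    exact ⟨β, max_le_iff.1 ((le_ciInf hβ).trans h)⟩
  · rintro ⟨β, h1, h2⟩
    exact (ciInf_le ⟨0, Set.forall_mem_range.2 hnn⟩ β).trans (max_le h1 h2)

lemma isCompact_Dhat (hμ : ∀ z, 0 ≤ μ z) (hμ0 : ∀ z, 0 ≤ μ0 z)
    (hsum : ∀ a, Summable fun z => μ z * Real.exp (dotZ d a z))
    (hsum0 : ∀ a, Summable fun z => μ0 z * Real.exp (dotZ d a z))
    (hirr : ∀ z z' : Zd d, ∃ n : ℕ, 0 < stepSn d μ n z z') : IsCompact (Dhat d μ μ0) := by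
  have hD := isCompact_jgf_le hμ hsum hirr 1
  have hE : IsCompact ({a | jgf d μ a ≤ 1} ∩ {a | jgf d μ0 a ≤ 1}) :=
    hD.inter_right (isClosed_le (continuous_jgf hμ0 hsum0) continuous_const)
  have hΘ : Theta d μ μ0 = Prod.fst '' ({a | jgf d μ a ≤ 1} ∩ {a : Rd d | jgf d μ0 a ≤ 1}) := by
    ext α
    rw [mem_Theta_iff hμ hμ0 hsum hsum0 hirr]
    simp
  have hcl : IsClosed (Theta d μ μ0) := by
    rw [hΘ]
    exact (hE.image continuous_fst).isClosed
  exact hD.inter_left (hcl.preimage continuous_fst)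

end Reflected

/-- A vector with nonnegative last coordinate is normal to `D̂` at some point of `D̂ ∩ ∂₊D`. -/
lemma exists_mem_bdPlus_normalCone {d : ℕ} {μ μ0 : Zd d → ℝ}
    (hμ : IsProb d μ) (hμ0 : IsProb d μ0) (hH2 : H2 d μ) (hH4 : H4 d μ μ0)
    {q : Rd d} (hq : 0 ≤ q.2) :
    ∃ a, a ∈ Dhat d μ μ0 ∧ a ∈ bdPlus d μ ∧ q ∈ normalCone d (Dhat d μ μ0) a := by
  have hcomp := isCompact_Dhat hμ.1 hμ0.1 (fun a => (hH4 a).1) (fun a => (hH4 a).2) hH2.1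
  have hne : (Dhat d μ μ0).Nonempty := by
    refine ⟨0, (mem_Theta_iff hμ.1 hμ0.1 (fun a => (hH4 a).1) (fun a => (hH4 a).2) hH2.1).2
      ⟨0, (jgf_zero hμ.2).le, (jgf_zero hμ0.2).le⟩, (jgf_zero hμ.2).le⟩
  obtain ⟨b, hb, hbmax⟩ := hcomp.exists_isMaxOn hne (continuous_dotR q).continuousOn
  have hfib : IsCompact (Dhat d μ μ0 ∩ {a | a.1 = b.1}) :=
    hcomp.inter_right (isClosed_eq continuous_fst continuous_const)
  obtain ⟨a, ⟨ha, hab⟩, hamax⟩ := hfib.exists_isMaxOn ⟨b, hb, rfl⟩ continuous_snd.continuousOn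
  have hab' : a.1 = b.1 := hab
  have hle : b.2 ≤ a.2 := hamax ⟨hb, rfl⟩
  refine ⟨a, ha, mem_bdPlus_of_forall_gt hμ.1 (fun a => (hH4 a).1) ha.2 fun t ht => ?_,
    fun c hc => ?_⟩
  · by_contra! h
    have hmem : a + (0, t) ∈ Dhat d μ μ0 ∩ {a | a.1 = b.1} :=
      ⟨⟨by simpa using ha.1, h⟩, by simpa using hab'⟩
    have : a.2 + t ≤ a.2 := hamax hmem
    linarith
  · have h1 : dotR d q c ≤ dotR d q b := hbmax hc
    have h2 : dotR d q b ≤ dotR d q a := by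
      simp only [dotR, hab']
      gcongr
    rw [dotR_sub]
    linarith

lemma eq_of_mem_normalCone {d : ℕ} {μ μ0 : Zd d → ℝ}
    (hμ : IsProb d μ) (hμ0 : IsProb d μ0) (hH0 : H0 d μ μ0) (hH1 : H1 d μ μ0) (hH2 : H2 d μ)
    (hH4 : H4 d μ μ0) {q : Rd d} (hq0 : q ≠ 0) (hq : 0 ≤ q.2) {a b : Rd d}
    (ha : a ∈ Dhat d μ μ0) (ha' : a ∈ bdPlus d μ) (hqa : q ∈ normalCone d (Dhat d μ μ0) a)
    (hb : b ∈ Dhat d μ μ0) (hb' : b ∈ bdPlus d μ) (hqb : q ∈ normalCone d (Dhat d μ μ0) b) :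
    a = b := by
  have hsum := fun a => (hH4 a).1
  have hsum0 := fun a => (hH4 a).2
  have hΘ {α} := mem_Theta_iff hμ.1 hμ0.1 hsum hsum0 hH2.1 (α := α)
  have hstrict := strictConvexOn_jgf hμ.1 hsum fun v hv => exists_dotZ_ne_zero hH2.1 hv
  have hconv0 := convexOn_jgf hμ0.1 hsum0
  have hcont := continuous_jgf hμ.1 hsum
  have hcont0 := continuous_jgf hμ0.1 hsum0
  have hqab : dotR d q a = dotR d q b := by
    have h1 := hqa b hb
    have h2 := hqb a ha
    rw [dotR_sub] at h1 h2
    linarith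
  have hmid {x y : Rd d} (hxy : x ≠ y) (hx : jgf d μ x ≤ 1) (hy : jgf d μ y ≤ 1) :
      jgf d μ ((1 / 2 : ℝ) • x + (1 / 2 : ℝ) • y) < 1 := by
    have := hstrict.2 (Set.mem_univ x) (Set.mem_univ y) hxy (half_pos one_pos) (half_pos one_pos)
      (add_halves 1)
    simp only [smul_eq_mul] at this
    linarith
  have hmid0 {x y : Rd d} (hx : jgf d μ0 x ≤ 1) (hy : jgf d μ0 y ≤ 1) :
      jgf d μ0 ((1 / 2 : ℝ) • x + (1 / 2 : ℝ) • y) ≤ 1 := by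
    have := hconv0.2 (Set.mem_univ x) (Set.mem_univ y) (half_pos one_pos).le (half_pos one_pos).le
      (add_halves 1)
    simp only [smul_eq_mul] at this
    linarith
  have hnear {ψ : Rd d → ℝ} (hψ : Continuous ψ) {c : Rd d} (hc : ψ c < 1) (v : Rd d) :
      ∀ᶠ t : ℝ in nhdsWithin 0 (Set.Ioi 0), ψ (c + t • v) < 1 := by
    have hct : Continuous fun t : ℝ => ψ (c + t • v) := by fun_prop
    refine nhdsWithin_le_nhds (hct.continuousAt.eventually_lt_const ?_)
    simpa using hc
  by_contra hab
  obtain ⟨β, hβ, hβ0⟩ := hΘ.1 ha.1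
  obtain ⟨γ, hγ, hγ0⟩ := hΘ.1 hb.1
  rcases hq.lt_or_eq with hpos | hzero
  · set c := (1 / 2 : ℝ) • a + (1 / 2 : ℝ) • b with hc
    obtain ⟨t, hct, ht⟩ := ((hnear hcont (hmid hab ha.2 hb.2) (0, 1)).and
      self_mem_nhdsWithin).exists
    have ht' : (0 : ℝ) < t := ht
    have hmem : c + t • (0, 1) ∈ Dhat d μ μ0 := by
      refine ⟨hΘ.2 ⟨1 / 2 * β + 1 / 2 * γ, ?_, ?_⟩, hct.le⟩
      · have := hstrict.convexOn.2 (Set.mem_univ (a.1, β)) (Set.mem_univ (b.1, γ))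
          (half_pos one_pos).le (half_pos one_pos).le (add_halves 1)
        simp only [smul_eq_mul] at this
        simp only [hc, Prod.fst_add, Prod.smul_fst, smul_zero, add_zero]
        refine le_trans this ?_
        linarith
      · simpa [hc] using hmid0 hβ0 hγ0
    have h := hqa _ hmem
    rw [dotR_sub, dotR_add, hc, dotR_add, dotR_smul, dotR_smul, dotR_smul, dotR_last] at h
    nlinarith [mul_pos ht' hpos]
  · by_cases hfst : a.1 = b.1
    · have hshift : ∀ x y : Rd d, x.1 = y.1 → x + (0, y.2 - x.2) = y := fun x y h =>
        Prod.ext (by simp [h]) (by simp)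
      rcases lt_trichotomy a.2 b.2 with h | h | h
      · have := one_lt_jgf_of_mem_bdPlus hμ.1 hsum hstrict ha' (sub_pos.2 h)
        rw [hshift a b hfst] at this
        exact this.ne' hb'.1
      · exact hab (Prod.ext hfst h)
      · have := one_lt_jgf_of_mem_bdPlus hμ.1 hsum hstrict hb' (sub_pos.2 h)
        rw [hshift b a hfst.symm] at this
        exact this.ne' ha'.1
    · set c : Rd d := (1 / 2 : ℝ) • (a.1, β) + (1 / 2 : ℝ) • (b.1, γ) with hc
      have hcμ : jgf d μ c < 1 := hmid (fun h => hfst (Prod.ext_iff.1 h).1) hβ hγ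
      obtain ⟨t, htμ, ht⟩ := ((hnear hcont hcμ (0, -1)).and self_mem_nhdsWithin).exists
      set e : Rd d := c + t • (0, -1) with he
      have heμ0 : jgf d μ0 e < 1 := by
        have := jgf_reflection_lt hμ0.1 hsum0 hH0.2 hH1 c ht
        have h2 : e = c + (0, -t) := by simp [he]
        rw [h2]
        exact this.trans_le (hmid0 hβ0 hγ0)
      obtain ⟨s, ⟨hs1, hs2⟩, hs⟩ := (((hnear hcont htμ q).and (hnear hcont0 heμ0 q)).and
        self_mem_nhdsWithin).exists
      have hs' : (0 : ℝ) < s := hs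
      have h := hqa (e + s • q) ⟨hΘ.2 ⟨(e + s • q).2, hs1.le, hs2.le⟩, hs1.le⟩
      have hflat : ∀ (α : Fin (d-1) → ℝ) (x y : ℝ), dotR d q (α, x) = dotR d q (α, y) := by
        simp [dotR, ← hzero]
      rw [dotR_sub, dotR_add, he, dotR_add, hc, dotR_add, dotR_smul, dotR_smul, dotR_smul,
        dotR_smul, dotR_last, ← hzero, hflat a.1 β a.2, hflat b.1 γ b.2] at h
      nlinarith [mul_pos hs' (dotR_self_pos hq0)]

/-- for every nonzero `q ∈ ℝ^{d-1}×[0,∞)` there is a unique point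
`â(q) ∈ D̂ ∩ ∂₊D` whose normal cone to `D̂` contains `q`. -/
theorem ahat_exists_unique
    (d : ℕ) (hd : 2 ≤ d) (μ μ0 : Zd d → ℝ)
    (hμ : IsProb d μ) (hμ0 : IsProb d μ0)
    (hH0 : H0 d μ μ0) (hH1 : H1 d μ μ0) (hH2 : H2 d μ)
    (hH3 : H3 d μ μ0) (hH4 : H4 d μ μ0) :
    ∀ q : Rd d, q ≠ 0 → 0 ≤ q.2 →
      ∃! a : Rd d, a ∈ Dhat d μ μ0 ∧ a ∈ bdPlus d μ ∧
        q ∈ normalCone d (Dhat d μ μ0) a := by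
  intro q hq0 hq
  obtain ⟨a, ha, ha', hqa⟩ := exists_mem_bdPlus_normalCone hμ hμ0 hH2 hH4 hq
  exact ⟨a, ⟨ha, ha', hqa⟩, fun b ⟨hb, hb', hqb⟩ =>
    eq_of_mem_normalCone hμ hμ0 hH0 hH1 hH2 hH4 hq0 hq hb hb' hqb ha ha' hqa⟩

end ReflectedRW
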